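/- For all integers m, n, t > 0 and all integers a, b with 0 ≤ b ≤ a ≤ n−t, the number of paths P ∈ D(m,n,t) with val(P,m) = a and ret(P) = b equals C(n−b−2, a−b)·C(mn−t+1, n−t−a) − m·C(n−b−1, a−b)·C(mn−t, n−t−a−1), as an identity of integers. -/

import Mathlib

/-- A step of a lattice path: north `(0,1)`, east `(1,0)` or diagonal `(1,1)`. -/
inductive Step : Type
  | N : Step
  | E : Step
  | D : Step
  deriving DecidableEq

/-- The displacement vector of a step. -/
def stepVec : Step → ℤ × ℤ
  | .N => (0, 1)
  | .E => (1, 0)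
  | .D => (1, 1)

/-- The lattice point reached after the first `k` steps of the path `P` (starting at the
origin). -/
def pt (P : List Step) (k : ℕ) : ℤ × ℤ := ((P.take k).map stepVec).sum

/-- The path `P` starts with at least `t` north steps. -/
def StartsNorth (t : ℤ) (P : List Step) : Prop := List.replicate t.toNat Step.N <+: P

/-- The path `P` stays weakly above the line `x = m·y`. -/
def AboveLine (m : ℤ) (P : List Step) : Prop := ∀ k : ℕ, (pt P k).1 ≤ m * (pt P k).2

/-- An `(m,t)`-Schröder path of height `n`: a lattice path from `(0,0)` to `(mn,n)` using
north, east and diagonal steps, starting with at least `t` north steps and never going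
below the line `x = m·y`. -/
def IsSchroeder (m n t : ℤ) (P : List Step) : Prop :=
  StartsNorth t P ∧ pt P P.length = (m * n, n) ∧ AboveLine m P

/-- An `(m,t)`-Dyck path of height `n`: an `(m,t)`-Schröder path of height `n` with no
diagonal steps. -/
def IsDyck (m n t : ℤ) (P : List Step) : Prop :=
  IsSchroeder m n t P ∧ ∀ s ∈ P, s ≠ Step.D

/-- A Schröder path is small if none of its diagonal steps starts on the line `x = m·y`. -/
def IsSmall (m : ℤ) (P : List Step) : Prop :=
  ∀ j : ℕ, P[j]? = some Step.D → (pt P j).1 ≠ m * (pt P j).2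

/-- A Schröder path is positive if it touches the line `x = m·y` only at its two
endpoints. -/
def IsPositive (m : ℤ) (P : List Step) : Prop :=
  ∀ k : ℕ, 0 < k → k < P.length → (pt P k).1 ≠ m * (pt P k).2

/-- The set of indices `j` such that the `j`-th step of `P` is east and the `(j+1)`-st is
north; the corresponding valley point is `pt P (j+1)`. -/
def valleys (P : List Step) : Finset ℕ :=
  (Finset.range P.length).filter fun j => P[j]? = some Step.E ∧ P[j + 1]? = some Step.N

/-- The number of valleys of `P`. -/
def val (P : List Step) : ℕ := (valleys P).card

/-- The number of valleys of `P` whose `x`-coordinate is congruent to `i` modulo `m`. -/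
def ival (m i : ℤ) (P : List Step) : ℕ :=
  ((valleys P).filter fun j => (pt P (j + 1)).1 % m = i % m).card

/-- The set of returns of `P`: valleys of the form `(m·i, i)`. -/
def returns (m : ℤ) (P : List Step) : Finset ℕ :=
  (valleys P).filter fun j => (pt P (j + 1)).1 = m * (pt P (j + 1)).2

/-- The number of returns of `P`. -/
def ret (m : ℤ) (P : List Step) : ℕ := (returns m P).card

/-- The set of indices of diagonal steps of `P`. -/
def diags (P : List Step) : Finset ℕ :=
  (Finset.range P.length).filter fun j => P[j]? = some Step.D

/-- The number of diagonal steps of `P`. -/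
def dg (P : List Step) : ℕ := (diags P).card

/-- A Schröder path is `m`-divisible if every diagonal step ends at an `x`-coordinate
divisible by `m`. -/
def MDivisible (m : ℤ) (P : List Step) : Prop :=
  ∀ j ∈ diags P, m ∣ (pt P (j + 1)).1

/-- The number of cornered diagonal steps of `P`: diagonal steps connecting `(i·m − 1, i)`
to `(i·m, i + 1)` for some `i`. -/
def cd (m : ℤ) (P : List Step) : ℕ :=
  ((diags P).filter fun j => (pt P (j + 1)).1 = m * ((pt P (j + 1)).2 - 1)).card

/-- The generalized binomial coefficient `C(p,q) = p(p−1)⋯(p−q+1)/q!` for integers `p` and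
`q ≥ 0`, and `C(p,q) = 0` for `q < 0`. -/
def C (p q : ℤ) : ℤ :=
  if q < 0 then 0
  else if 0 ≤ p then (p.toNat.choose q.toNat : ℤ)
  else (-1) ^ q.toNat * ((q - p - 1).toNat.choose q.toNat : ℤ)

/-- The number of valleys of `P` at which `p` holds of the remaining displacement, for a path
that starts with displacement `(X, Y)` left to go; the flag records whether the step leading to
the starting point is east. -/
def valleyCount (p : ℤ → ℤ → Prop) [DecidableRel p] : Bool → ℤ → ℤ → List Step → ℕ
  | _, _, _, [] => 0
  | _, X, Y, .E :: P => valleyCount p true (X - 1) Y P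
  | e, X, Y, .N :: P => (if e = true ∧ p X Y then 1 else 0) + valleyCount p false X (Y - 1) P
  | _, X, Y, .D :: P => valleyCount p false (X - 1) (Y - 1) P

/-- `P` has displacement `(X, Y)`, uses no diagonal steps, and after each step the remaining
displacement `(X', Y')` satisfies `m * Y' ≤ X'`. -/
def IsCompletion (m : ℤ) : ℤ → ℤ → List Step → Prop
  | X, Y, [] => X = 0 ∧ Y = 0
  | X, Y, .E :: P => m * Y ≤ X - 1 ∧ IsCompletion m (X - 1) Y P
  | X, Y, .N :: P => m * (Y - 1) ≤ X ∧ IsCompletion m X (Y - 1) P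
  | _, _, .D :: _ => False

/-- The completions from remaining displacement `(X, Y)` having `a` valleys with abscissa
divisible by `m` and `b` valleys on the line. -/
def completions (m : ℤ) (e : Bool) (X Y a b : ℤ) : Set (List Step) :=
  {P | IsCompletion m X Y P ∧ (valleyCount (fun X _ => m ∣ X) e X Y P : ℤ) = a ∧
    (valleyCount (fun X Y => X = m * Y) e X Y P : ℤ) = b}

/-- The closed form for the number of completions with `k` full blocks of columns left. -/
def completionFormula (m X Y k a b : ℤ) : ℤ :=
  C (k - b - 1) (a - b) * C (Y + X - k) (Y - a)
    - m * C (k - b) (a - b) * C (Y + X - k - 1) (Y - a - 1)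

theorem C_of_neg {p q : ℤ} (h : q < 0) : C p q = 0 := by simp [C, h]

theorem C_zero_right (p : ℤ) : C p 0 = 1 := by simp [C]

theorem C_natCast (p q : ℕ) : C p q = p.choose q := by simp [C]

theorem C_natCast_right (p : ℤ) (q : ℕ) : C p q = Ring.choose p q := by
  unfold C
  rw [if_neg (by omega)]
  split_ifs with h
  · lift p to ℕ using h
    simp [Ring.choose_natCast]
  · obtain ⟨r, rfl⟩ : ∃ r, p = -r := ⟨-p, by simp⟩
    rw [Ring.choose_neg]
    obtain ⟨s, hs⟩ : ∃ s : ℕ, r + q - 1 = s := ⟨(r + q - 1).toNat, by omega⟩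
    rw [hs, show (q : ℤ) - -r - 1 = s by omega, Ring.choose_natCast]
    simp [Int.negOnePow_def, Units.smul_def]

theorem C_add_one (p q : ℤ) : C (p + 1) q = C p q + C p (q - 1) := by
  rcases lt_trichotomy q 0 with h | rfl | h
  · simp [C_of_neg h, C_of_neg (show q - 1 < 0 by omega)]
  · simp [C_zero_right, C_of_neg]
  · obtain ⟨r, rfl⟩ : ∃ r : ℕ, q = r + 1 := ⟨(q - 1).toNat, by omega⟩
    have h₁ := C_natCast_right (p + 1) (r + 1)
    have h₂ := C_natCast_right p (r + 1)
    push_cast at h₁ h₂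
    rw [h₁, h₂, add_sub_cancel_right, C_natCast_right, Ring.choose_succ_succ, add_comm]

theorem completionFormula_sub_one (m X Y k a b : ℤ) :
    completionFormula m X Y k a b =
      completionFormula m (X - 1) Y k a b + completionFormula m X (Y - 1) k a b := by
  unfold completionFormula
  have h₁ := C_add_one (Y + X - k - 1) (Y - a)
  have h₂ := C_add_one (Y + X - k - 2) (Y - a - 1)
  ring_nf at h₁ h₂ ⊢
  rw [h₁, h₂]
  ring

theorem completionFormula_block (m X Y k a b : ℤ) :
    completionFormula m X Y k a b =
      completionFormula m (X - 1) Y (k - 1) a b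
        + completionFormula m X (Y - 1) (k - 1) (a - 1) b := by
  unfold completionFormula
  have h₁ := C_add_one (k - b - 2) (a - b)
  have h₂ := C_add_one (k - b - 1) (a - b)
  rw [show k - b - 2 + 1 = k - b - 1 by ring] at h₁
  rw [show k - b - 1 + 1 = k - b by ring] at h₂
  rw [show k - 1 - b - 1 = k - b - 2 by ring, show k - 1 - b = k - b - 1 by ring,
    show a - 1 - b = a - b - 1 by ring, show Y + (X - 1) - (k - 1) = Y + X - k by ring,
    show Y - 1 + X - (k - 1) = Y + X - k by ring, show Y - 1 - (a - 1) = Y - a by ring, h₂, h₁]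
  ring

theorem completionFormula_return (m X Y k a b : ℤ) :
    completionFormula m X Y k a b =
      completionFormula m X (Y - 1) (k - 1) (a - 1) (b - 1) := by
  unfold completionFormula
  ring_nf

theorem completionFormula_of_lt (m X Y k : ℤ) {a b : ℤ} (h : a < b) :
    completionFormula m X Y k a b = 0 := by
  simp [completionFormula, C_of_neg (show a - b < 0 by omega)]

theorem completionFormula_of_height_lt (m X k b : ℤ) {Y a : ℤ} (h : Y < a) :
    completionFormula m X Y k a b = 0 := by
  simp [completionFormula, C_of_neg (show Y - a < 0 by omega),
    C_of_neg (show Y - a - 1 < 0 by omega)]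

theorem completionFormula_no_return {m k : ℤ} (hm : 0 < m) (hk : 0 < k) (a : ℤ) :
    completionFormula m (m * k) k k a 0 = 0 := by
  rcases lt_or_ge a 0 with ha | ha
  · exact completionFormula_of_lt _ _ _ _ ha
  rcases lt_or_ge k a with hka | hka
  · exact completionFormula_of_height_lt _ _ _ _ hka
  lift a to ℕ using ha
  obtain ⟨r, rfl⟩ : ∃ r : ℕ, k = a + r := ⟨(k - a).toNat, by omega⟩
  lift m to ℕ using hm.le
  unfold completionFormula
  rcases r with _ | r
  · obtain ⟨s, rfl⟩ : ∃ s : ℕ, a = s + 1 := ⟨a - 1, by omega⟩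
    have h := C_natCast s (s + 1)
    push_cast at h
    simp [C_of_neg, h]
  obtain ⟨s, hs⟩ : ∃ s : ℕ, m * (a + (r + 1)) = s + 1 :=
    ⟨m * (a + (r + 1)) - 1, by
      have : 0 < m * (a + (r + 1)) := Nat.mul_pos (by omega) (by omega)
      omega⟩
  have hs' : (m : ℤ) * (a + (r + 1)) = s + 1 := by exact_mod_cast hs
  push_cast
  have e₁ : C ((a : ℤ) + (r + 1) - 0 - 1) (a - 0) = (a + r).choose a := by
    rw [← C_natCast]; push_cast; ring_nf
  have e₂ : C ((a : ℤ) + (r + 1) - 0) (a - 0) = (a + r + 1).choose a := by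
    rw [← C_natCast]; push_cast; ring_nf
  have e₃ : C ((a : ℤ) + (r + 1) + m * (a + (r + 1)) - (a + (r + 1))) (a + (r + 1) - a)
      = (s + 1).choose (r + 1) := by
    rw [← C_natCast, hs']; push_cast; ring_nf
  have e₄ : C ((a : ℤ) + (r + 1) + m * (a + (r + 1)) - (a + (r + 1)) - 1)
      (a + (r + 1) - a - 1) = s.choose r := by
    rw [← C_natCast, hs']; ring_nf
  rw [e₁, e₂, e₃, e₄]
  have h₁ : ((a + r).choose a : ℤ) * (a + r + 1) = (a + r + 1).choose a * (r + 1) := by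
    have := Nat.choose_mul_succ_eq (a + r) a
    rw [show a + r + 1 - a = r + 1 by omega] at this
    exact_mod_cast this
  have h₂ : ((s : ℤ) + 1) * s.choose r = (s + 1).choose (r + 1) * (r + 1) := by
    exact_mod_cast Nat.add_one_mul_choose_eq s r
  have hr : ((a : ℤ) + r + 1) * (r + 1) ≠ 0 := by positivity
  apply mul_right_cancel₀ hr
  rw [← hs'] at h₂
  linear_combination (((s + 1).choose (r + 1) : ℤ)) * (r + 1) * h₁
    - (r + 1) * ((a + r + 1).choose a : ℤ) * h₂

theorem IsCompletion.length_eq {m : ℤ} : ∀ {P : List Step} {X Y : ℤ},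
    IsCompletion m X Y P → (P.length : ℤ) = X + Y
  | [], _, _, h => by simp [h.1, h.2]
  | .E :: P, _, _, h => by have := h.2.length_eq; simp; omega
  | .N :: P, _, _, h => by have := h.2.length_eq; simp; omega

theorem IsCompletion.height_nonneg {m : ℤ} : ∀ {P : List Step} {X Y : ℤ},
    IsCompletion m X Y P → 0 ≤ Y
  | [], _, _, h => h.2.ge
  | .E :: P, _, _, h => h.2.height_nonneg
  | .N :: P, _, _, h => by have := h.2.height_nonneg; omega

instance : Finite Step :=
  Finite.of_injective (fun s : Step => (match s with | .N => 0 | .E => 1 | .D => 2 : Fin 3))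
    (by rintro (_ | _ | _) (_ | _ | _) h <;> simp_all)

theorem finite_completions (m : ℤ) (e : Bool) (X Y a b : ℤ) :
    (completions m e X Y a b).Finite :=
  (List.finite_length_eq Step (X + Y).toNat).subset fun P hP => by
    have := hP.1.length_eq
    simp only [Set.mem_ofPred_eq]
    omega

theorem completions_of_height_neg (m : ℤ) (e : Bool) (X a b : ℤ) {Y : ℤ} (h : Y < 0) :
    completions m e X Y a b = ∅ := by
  ext P
  simp only [Set.mem_empty_iff_false, iff_false]
  intro hP
  have := hP.1.height_nonneg
  omega

theorem completions_of_returns_neg (m : ℤ) (e : Bool) (X Y a : ℤ) {b : ℤ} (h : b < 0) :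
    completions m e X Y a b = ∅ := by
  ext P
  simp only [Set.mem_empty_iff_false, iff_false]
  intro hP
  have := hP.2.2
  omega

theorem ncard_completions_zero (m a b : ℤ) :
    (completions m true 0 0 a b).ncard = if a = 0 ∧ b = 0 then 1 else 0 := by
  have key : ∀ P, IsCompletion m 0 0 P ↔ P = [] := fun P => by
    refine ⟨fun h => ?_, fun h => by simp [h, IsCompletion]⟩
    simpa using h.length_eq
  have : completions m true 0 0 a b = if a = 0 ∧ b = 0 then {[]} else ∅ := by
    ext P
    simp only [completions, key, Set.mem_ofPred_eq]
    split_ifs with h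
    · simp only [Set.mem_singleton_iff, and_iff_left_iff_imp]
      rintro rfl
      simp [valleyCount, h]
    · simp only [Set.mem_empty_iff_false, iff_false]
      rintro ⟨rfl, h₁, h₂⟩
      simp only [valleyCount] at h₁ h₂
      omega
  rw [this]
  split_ifs <;> simp

theorem ncard_completions {m X Y : ℤ} (hm : 0 < m) (hXY : m * Y ≤ X) (h0 : 0 < X + Y)
    (e : Bool) (a b : ℤ) :
    (completions m e X Y a b).ncard =
      (if m * Y ≤ X - 1 then (completions m true (X - 1) Y a b).ncard else 0)
        + (completions m false X (Y - 1) (a - if e = true ∧ m ∣ X then 1 else 0)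
            (b - if e = true ∧ X = m * Y then 1 else 0)).ncard := by
  have hN : m * (Y - 1) ≤ X := by linarith
  have hset : completions m e X Y a b =
      (List.cons Step.E '' (if m * Y ≤ X - 1 then completions m true (X - 1) Y a b else ∅))
        ∪ List.cons Step.N '' (completions m false X (Y - 1)
            (a - if e = true ∧ m ∣ X then 1 else 0)
            (b - if e = true ∧ X = m * Y then 1 else 0)) := by
    ext P
    rcases P with _ | ⟨_ | _ | _, P⟩
    · simp only [completions, IsCompletion, Set.mem_ofPred_eq, Set.mem_union, Set.mem_image,
        reduceCtorEq, and_false, exists_false, or_self, iff_false]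
      omega
    · simp only [completions, IsCompletion, valleyCount, hN, Set.mem_ofPred_eq, Set.mem_union,
        Set.mem_image, List.cons.injEq, reduceCtorEq, false_and, and_false, exists_false,
        false_or, true_and, exists_eq_right, Nat.cast_add, Nat.cast_ite, Nat.cast_one,
        Nat.cast_zero, eq_sub_iff_add_eq']
    · split_ifs with h <;> simp [completions, IsCompletion, valleyCount, h]
    · simp [completions, IsCompletion]
  have hfin : (if m * Y ≤ X - 1 then completions m true (X - 1) Y a b else ∅).Finite := by
    split_ifs
    · exact finite_completions ..
    · exact Set.finite_empty
  rw [hset, Set.ncard_union_eq _ (hfin.image _) ((finite_completions ..).image _),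
    Set.ncard_image_of_injective _ List.cons_injective,
    Set.ncard_image_of_injective _ List.cons_injective]
  · split_ifs <;> simp
  · rw [Set.disjoint_left]
    rintro _ ⟨P, -, rfl⟩ ⟨Q, -, h⟩
    simp at h

/-- Both kinds of completions, following an east step and not, are counted by the closed form;
the two differ in the block to which a column with abscissa divisible by `m` is assigned. -/
theorem ncard_completions_eq_formula {m : ℤ} (hm : 0 < m) (L : ℕ) :
    ∀ X Y k j a b : ℤ, X + Y = L → X = m * k + j → 0 ≤ Y → Y ≤ k → 0 ≤ b →
      (0 ≤ j → j < m →
        ((completions m true X Y a b).ncard : ℤ) = completionFormula m X Y k a b) ∧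
      (0 < j → j ≤ m →
        ((completions m false X Y a b).ncard : ℤ) = completionFormula m X Y k a b) := by
  induction L with
  | zero =>
    intro X Y k j a b hL hX hY hYk hb
    have hmk : 0 ≤ m * k := mul_nonneg hm.le (hY.trans hYk)
    refine ⟨fun hj hjm => ?_, fun hj hjm => by push_cast at hL; omega⟩
    obtain rfl : X = 0 := by push_cast at hL; omega
    obtain rfl : Y = 0 := by push_cast at hL; omega
    obtain rfl : j = 0 := by omega
    obtain rfl : k = 0 := by
      rcases mul_eq_zero.mp (show m * k = 0 by omega) with h | h <;> omega
    rw [ncard_completions_zero]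
    rcases lt_trichotomy a 0 with h | rfl | h
    · rw [completionFormula_of_lt _ _ _ _ (by omega), if_neg (by omega)]; rfl
    · rcases hb.eq_or_lt with rfl | hb
      · simp [completionFormula, C_zero_right, C_of_neg]
      · rw [completionFormula_of_lt _ _ _ _ hb, if_neg (by omega)]; rfl
    · rw [completionFormula_of_height_lt _ _ _ _ h, if_neg (by omega)]; rfl
  | succ L ih =>
    intro X Y k j a b hL hX hY hYk hb
    push_cast at hL
    have hmY : m * Y ≤ m * k := by gcongr
    have hNorth : ∀ k' j' a' b', X = m * k' + j' → 0 < j' → j' ≤ m → Y - 1 ≤ k' → 0 ≤ b' →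
        ((completions m false X (Y - 1) a' b').ncard : ℤ)
          = completionFormula m X (Y - 1) k' a' b' := by
      intro k' j' a' b' hX' hj hjm hYk' hb'
      rcases hY.eq_or_lt with rfl | hY
      · rw [completions_of_height_neg _ _ _ _ _ (by omega), Set.ncard_empty]
        rcases lt_or_ge a' 0 with ha' | ha'
        · rw [completionFormula_of_lt _ _ _ _ (by omega)]; rfl
        · rw [completionFormula_of_height_lt _ _ _ _ (by omega)]; rfl
      · exact (ih X (Y - 1) k' j' a' b' (by omega) hX' (by omega) hYk' hb').2 hj hjm
    have hFalse : 0 < j → j ≤ m →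
        ((completions m false X Y a b).ncard : ℤ) = completionFormula m X Y k a b := by
      intro hj hjm
      rw [ncard_completions hm (by omega) (by omega), if_pos (by omega)]
      push_cast
      rw [(ih (X - 1) Y k (j - 1) a b (by omega) (by omega) hY hYk hb).1 (by omega) (by omega)]
      simp only [false_and, if_false, sub_zero]
      rw [hNorth k j a b hX hj hjm (by omega) hb, ← completionFormula_sub_one]
    refine ⟨fun hj hjm => ?_, hFalse⟩
    rcases hj.eq_or_lt with rfl | hj
    · rw [add_zero] at hX
      have hk : 0 < k := by
        rcases (hY.trans hYk).eq_or_lt with rfl | h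
        · rw [mul_zero] at hX; omega
        · exact h
      have hX' : X = m * (k - 1) + m := by linarith
      have hdvd : m ∣ X := ⟨k, hX⟩
      rw [ncard_completions hm (by omega) (by omega)]
      rcases hYk.eq_or_lt with rfl | hlt
      · rw [if_neg (by omega), if_pos ⟨rfl, hdvd⟩, if_pos ⟨rfl, hX⟩, zero_add]
        rcases hb.eq_or_lt with rfl | hb
        · rw [completions_of_returns_neg _ _ _ _ _ (by omega), hX,
            completionFormula_no_return hm hk, Set.ncard_empty]
          rfl
        · rw [hNorth (Y - 1) m (a - 1) (b - 1) hX' hm le_rfl le_rfl (by omega),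
            ← completionFormula_return]
      · have hmlt : m * Y < m * k := by gcongr
        rw [if_pos (by omega), if_pos ⟨rfl, hdvd⟩, if_neg (by omega), sub_zero]
        push_cast
        rw [hNorth (k - 1) m (a - 1) b hX' hm le_rfl (by omega) hb,
          (ih (X - 1) Y (k - 1) (m - 1) a b (by omega) (by linarith) hY (by omega) hb).1
            (by omega) (by omega), ← completionFormula_block]
    · rw [← hFalse hj hjm.le, ncard_completions hm (X := X) (Y := Y) (by omega) (by omega) true,
        ncard_completions hm (X := X) (Y := Y) (by omega) (by omega) false]
      have hdvd : ¬ m ∣ X := by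
        rw [hX, dvd_add_right (dvd_mul_right m k)]
        exact fun h => absurd (Int.le_of_dvd hj h) (by omega)
      have hne : X ≠ m * Y := fun h => hdvd ⟨Y, h⟩
      simp [hdvd, hne]

theorem pt_zero (P : List Step) : pt P 0 = 0 := by simp [pt]

theorem pt_cons_succ (s : Step) (P : List Step) (k : ℕ) :
    pt (s :: P) (k + 1) = stepVec s + pt P k := by simp [pt]

theorem card_filter_valleys (p : ℤ → ℤ → Prop) [DecidableRel p] (P : List Step) :
    ∀ (e : Bool) (X Y : ℤ),
      (if e = true ∧ P[0]? = some Step.N ∧ p X Y then 1 else 0)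
        + ((valleys P).filter fun j =>
            p (X - (pt P (j + 1)).1) (Y - (pt P (j + 1)).2)).card
      = valleyCount p e X Y P := by
  induction P with
  | nil => simp [valleys, valleyCount]
  | cons s P ih =>
    intro e X Y
    rw [valleys, Finset.filter_filter, Finset.card_filter, List.length_cons,
      Finset.sum_range_succ']
    simp only [pt_cons_succ, pt_zero, List.getElem?_cons_succ, List.getElem?_cons_zero,
      Prod.fst_add, Prod.snd_add, ← sub_sub, Prod.fst_zero, Prod.snd_zero, sub_zero, zero_add]
    rw [← Finset.card_filter, ← Finset.filter_filter]
    rcases s with _ | _ | _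
    · rw [valleyCount, ← ih]
      simp [stepVec, valleys]
    · rw [valleyCount, ← ih]
      simp [stepVec, valleys, add_comm]
    · rw [valleyCount, ← ih]
      simp only [stepVec, valleys, Option.some.injEq, reduceCtorEq, false_and, and_false,
        if_false, add_zero, Bool.false_eq_true, zero_add]
      congr!

theorem isCompletion_iff (m : ℤ) (P : List Step) : ∀ X Y : ℤ, m * Y ≤ X →
    (IsCompletion m X Y P ↔ pt P P.length = (X, Y) ∧
      (∀ k, m * (Y - (pt P k).2) ≤ X - (pt P k).1) ∧ ∀ s ∈ P, s ≠ Step.D) := by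
  induction P with
  | nil =>
    intro X Y h
    simp [IsCompletion, pt, h, Prod.ext_iff, eq_comm]
  | cons s P ih =>
    intro X Y h
    have hforall : (∀ k, m * (Y - (pt (s :: P) k).2) ≤ X - (pt (s :: P) k).1) ↔
        ∀ k, m * (Y - (stepVec s).2 - (pt P k).2) ≤ X - (stepVec s).1 - (pt P k).1 := by
      rw [← Nat.and_forall_add_one]
      simp [pt_cons_succ, pt_zero, h, sub_sub]
    have hend : pt (s :: P) (s :: P).length = (X, Y) ↔
        pt P P.length = (X - (stepVec s).1, Y - (stepVec s).2) := by
      rw [List.length_cons, pt_cons_succ, Prod.ext_iff, Prod.ext_iff]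
      simp [eq_sub_iff_add_eq']
    have hstart : (∀ k, m * (Y - (stepVec s).2 - (pt P k).2) ≤ X - (stepVec s).1 - (pt P k).1) →
        m * (Y - (stepVec s).2) ≤ X - (stepVec s).1 := fun h => by
      simpa [pt_zero] using h 0
    rw [hforall, hend]
    rcases s with _ | _ | _
    · simp only [stepVec, sub_zero] at hstart ⊢
      simp only [IsCompletion, List.mem_cons, forall_eq_or_imp, ne_eq, reduceCtorEq,
        not_false_eq_true, true_and]
      constructor
      · rintro ⟨h₁, h₂⟩
        exact (ih _ _ h₁).1 h₂
      · intro h₂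
        exact ⟨hstart h₂.2.1, (ih _ _ (hstart h₂.2.1)).2 h₂⟩
    · simp only [stepVec, sub_zero] at hstart ⊢
      simp only [IsCompletion, List.mem_cons, forall_eq_or_imp, ne_eq, reduceCtorEq,
        not_false_eq_true, true_and]
      constructor
      · rintro ⟨h₁, h₂⟩
        exact (ih _ _ h₁).1 h₂
      · intro h₂
        exact ⟨hstart h₂.2.1, (ih _ _ (hstart h₂.2.1)).2 h₂⟩
    · simp [IsCompletion]

theorem valleyCount_replicate_append (p : ℤ → ℤ → Prop) [DecidableRel p] (X : ℤ)
    (Q : List Step) (t : ℕ) : ∀ Y, valleyCount p false X Y (List.replicate t Step.N ++ Q)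
      = valleyCount p false X (Y - t) Q := by
  induction t with
  | zero => simp
  | succ t ih =>
    intro Y
    rw [List.replicate_succ, List.cons_append, valleyCount, ih]
    simp [sub_sub, add_comm]

theorem isCompletion_replicate_append {m : ℤ} (hm : 0 < m) (X : ℤ) (Q : List Step) (t : ℕ) :
    ∀ Y, m * Y ≤ X → (IsCompletion m X Y (List.replicate t Step.N ++ Q)
      ↔ IsCompletion m X (Y - t) Q) := by
  induction t with
  | zero => simp
  | succ t ih =>
    intro Y h
    have h' : m * (Y - 1) ≤ X := by linarith
    rw [List.replicate_succ, List.cons_append, IsCompletion, ih _ h', and_iff_right h']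
    simp [sub_sub, add_comm]

theorem ival_self_eq_valleyCount (m n : ℤ) (P : List Step) :
    ival m m P = valleyCount (fun X _ => m ∣ X) false (m * n) n P := by
  rw [← card_filter_valleys, ival]
  simp [dvd_sub_right (dvd_mul_right m n)]

theorem ret_eq_valleyCount (m n : ℤ) (P : List Step) :
    ret m P = valleyCount (fun X Y => X = m * Y) false (m * n) n P := by
  rw [← card_filter_valleys, ret, returns]
  simp [mul_sub]

theorem isDyck_iff (m n t : ℤ) (P : List Step) :
    IsDyck m n t P ↔ StartsNorth t P ∧ IsCompletion m (m * n) n P := by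
  have h (k : ℕ) : m * (n - (pt P k).2) ≤ m * n - (pt P k).1 ↔
      (pt P k).1 ≤ m * (pt P k).2 := by rw [mul_sub, sub_le_sub_iff_left]
  rw [isCompletion_iff m P _ _ le_rfl, IsDyck, IsSchroeder, AboveLine]
  simp only [h, and_assoc]

theorem setOf_isDyck_eq_image {m t : ℤ} (hm : 0 < m) (ht : 0 ≤ t) (n a b : ℤ) :
    {P : List Step | IsDyck m n t P ∧ (ival m m P : ℤ) = a ∧ (ret m P : ℤ) = b}
      = (List.replicate t.toNat Step.N ++ ·) '' completions m false (m * n) (n - t) a b := by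
  lift t to ℕ using ht
  ext P
  simp only [completions, Set.mem_image, Set.mem_ofPred_eq, isDyck_iff,
    ival_self_eq_valleyCount m n, ret_eq_valleyCount m n, StartsNorth, Int.toNat_natCast]
  constructor
  · rintro ⟨⟨⟨Q, rfl⟩, h₁⟩, h₂⟩
    rw [isCompletion_replicate_append hm _ _ _ _ le_rfl] at h₁
    rw [valleyCount_replicate_append, valleyCount_replicate_append] at h₂
    exact ⟨Q, ⟨h₁, h₂⟩, rfl⟩
  · rintro ⟨Q, ⟨h₁, h₂⟩, rfl⟩
    rw [isCompletion_replicate_append hm _ _ _ _ le_rfl, valleyCount_replicate_append,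
      valleyCount_replicate_append]
    exact ⟨⟨⟨Q, rfl⟩, h₁⟩, h₂⟩

/-- the number of `(m,t)`-Dyck paths of height `n` with `a` `m`-valleys and
`b` returns. -/
theorem statement2 (m n t a b : ℤ) (hm : 0 < m) (hn : 0 < n) (ht : 0 < t)
    (hb : 0 ≤ b) (hba : b ≤ a) (ha : a ≤ n - t) :
    (({P : List Step | IsDyck m n t P ∧ (ival m m P : ℤ) = a ∧ (ret m P : ℤ) = b}.ncard : ℤ))
      = C (n - b - 2) (a - b) * C (m * n - t + 1) (n - t - a)
        - m * C (n - b - 1) (a - b) * C (m * n - t) (n - t - a - 1) := by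
  rw [setOf_isDyck_eq_image hm ht.le,
    Set.ncard_image_of_injective _ (List.append_right_injective _)]
  obtain ⟨L, hL⟩ : ∃ L : ℕ, m * n + (n - t) = L :=
    ⟨(m * n + (n - t)).toNat, by
      have : 0 ≤ m * n := mul_nonneg hm.le hn.le
      omega⟩
  rw [(ncard_completions_eq_formula hm L (m * n) (n - t) (n - 1) m a b hL (by ring) (by omega)
    (by omega) hb).2 hm le_rfl, completionFormula]
  rw [show n - 1 - b - 1 = n - b - 2 by ring, show n - 1 - b = n - b - 1 by ring,
    show n - t + m * n - (n - 1) = m * n - t + 1 by ring,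
    show m * n - t + 1 - 1 = m * n - t by ring]
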